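/- Define Λ(ξ) := ξ₃/‖ξ‖ for ξ ≠ 0, s(ξ) := √(1−Λ(ξ)²), write ξ_h := (ξ₁,ξ₂,0), and for ξ with ξ_h ≠ 0 let w(ξ) := (Λ(ξ)/s(ξ))·ξ_h − ‖ξ‖·s(ξ)·e₃. Let ξ, η ∈ ℝ³ with ξ_h ≠ 0 and ξ ≠ η, and let μ ∈ {−1,+1}. Then the map ξ' ↦ Λ(ξ') + μ·Λ(ξ'−η) is differentiable at ξ, and its directional derivative at ξ in the direction w(ξ) satisfies | w(ξ)·∇_ξ[Λ(ξ) + μΛ(ξ−η)] | ≤ √(1−Λ(ξ)²) + (‖ξ‖/‖ξ−η‖)·√(1−Λ(ξ−η)²). -/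

import Mathlib

open MeasureTheory RealInnerProductSpace

noncomputable section

/-- Euclidean 3-space. -/
abbrev E3 : Type := EuclideanSpace ℝ (Fin 3)

/-- The vector `(a, b, c) ∈ ℝ³`. -/
def Ev3 (a b c : ℝ) : E3 := (WithLp.equiv 2 (Fin 3 → ℝ)).symm ![a, b, c]

/-- Horizontal part `v_h = (v₁, v₂, 0)` of a vector `v ∈ ℝ³`. -/
def hpart (v : E3) : E3 := Ev3 (v 0) (v 1) 0

/-- Horizontal rotation by 90 degrees: `v_h^⊥ = (−v₂, v₁, 0)`. -/
def hperp (v : E3) : E3 := Ev3 (-(v 1)) (v 0) 0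

/-- The quantity `σ̄(ξ,η) := ξ₃ η_h − η₃ ξ_h`. -/
def sigmaBar (ξ η : E3) : E3 := (ξ 2) • hpart η - (η 2) • hpart ξ

/-- The dispersion relation `Λ(ξ) = ξ₃ / ‖ξ‖`. -/
def Lam (ξ : E3) : ℝ := ξ 2 / ‖ξ‖

/-- `s(ξ) := √(1 − Λ(ξ)²)`. -/
def sfun (ξ : E3) : ℝ := Real.sqrt (1 - Lam ξ ^ 2)

/-- The vertical unit vector `e₃`. -/
def e₃ : E3 := Ev3 0 0 1

/-- The direction `w(ξ) = (Λ(ξ)/s(ξ)) ξ_h − ‖ξ‖ s(ξ) e₃` of the vector field `Υ = ∂_φ`. -/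
def wvec (ξ : E3) : E3 := (Lam ξ / sfun ξ) • hpart ξ - (‖ξ‖ * sfun ξ) • e₃

theorem norm_sq_E3 (v : E3) : ‖v‖ ^ 2 = v 0 ^ 2 + v 1 ^ 2 + v 2 ^ 2 := by
  rw [EuclideanSpace.norm_sq_eq, Fin.sum_univ_three]
  simp only [Real.norm_eq_abs, sq_abs]

/-- The gradient of the dispersion relation. -/
def gradLam (x : E3) : E3 := ‖x‖⁻¹ • e₃ - (x 2 / ‖x‖ ^ 3) • x

theorem inner_e₃_left (v : E3) : ⟪e₃, v⟫ = v 2 := by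
  simp [e₃, Ev3, PiLp.inner_apply, Fin.sum_univ_three]

theorem norm_e₃ : ‖e₃‖ = 1 := by
  have h : ‖e₃‖ ^ 2 = 1 := by
    rw [norm_sq_E3]
    simp [e₃, Ev3]
  exact (pow_eq_one_iff_of_nonneg (norm_nonneg _) two_ne_zero).mp h

theorem hasFDerivAt_Lam {x : E3} (hx : x ≠ 0) :
    HasFDerivAt Lam (innerSL ℝ (gradLam x)) x := by
  have hn : ‖x‖ ≠ 0 := norm_ne_zero_iff.mpr hx
  have hcoord : HasFDerivAt (fun y : E3 => y 2) (innerSL ℝ e₃) x := by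
    have h := (innerSL ℝ e₃).hasFDerivAt (x := x)
    refine h.congr_of_eventuallyEq (Filter.Eventually.of_forall fun y => ?_)
    simp [inner_e₃_left]
  have hnorm : HasFDerivAt (fun y : E3 => ‖y‖) (‖x‖⁻¹ • innerSL ℝ x) x := by
    have h := (hasStrictFDerivAt_norm_sq x).hasFDerivAt.sqrt (pow_ne_zero 2 hn)
    simp only [Real.sqrt_sq (norm_nonneg _)] at h
    refine h.congr_fderiv ?_
    ext v
    simp only [smul_apply, smul_eq_mul, nsmul_eq_mul, Nat.cast_ofNat]
    field_simp
  have h := hcoord.mul ((hasDerivAt_inv hn).comp_hasFDerivAt x hnorm)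
  refine HasFDerivAt.congr_fderiv h ?_
  ext v
  simp [gradLam]
  field_simp
  ring

theorem norm_gradLam {x : E3} (hx : x ≠ 0) : ‖gradLam x‖ = sfun x / ‖x‖ := by
  have hn : ‖x‖ ≠ 0 := norm_ne_zero_iff.mpr hx
  have h : ‖gradLam x‖ ^ 2 = (1 - Lam x ^ 2) / ‖x‖ ^ 2 := by
    rw [gradLam, norm_sub_sq_real, inner_smul_left, inner_smul_right, inner_e₃_left,
      norm_smul, norm_smul, norm_e₃, Lam]
    simp only [mul_pow, Real.norm_eq_abs, sq_abs, conj_trivial]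
    field_simp
    ring
  rw [sfun, ← Real.sqrt_sq (norm_nonneg (gradLam x)), h, Real.sqrt_div' _ (sq_nonneg _),
    Real.sqrt_sq (norm_nonneg x)]

theorem norm_wvec {x : E3} (hx : hpart x ≠ 0) : ‖wvec x‖ = ‖x‖ := by
  have hp : 0 < x 0 ^ 2 + x 1 ^ 2 := by
    have h := norm_sq_E3 (hpart x)
    have h' : 0 < ‖hpart x‖ ^ 2 := by positivity
    simp [hpart, Ev3] at h
    rw [hpart, Ev3] at h'
    simpa [h] using h'
  have hx2 := norm_sq_E3 x
  have hn2 : 0 < ‖x‖ ^ 2 := by nlinarith [sq_nonneg (x 2)]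
  have hn : ‖x‖ ≠ 0 := fun h => by simp [h] at hn2
  have hL : 1 - Lam x ^ 2 = (x 0 ^ 2 + x 1 ^ 2) / ‖x‖ ^ 2 := by
    rw [Lam, div_pow, eq_div_iff hn2.ne', sub_mul, div_mul_cancel₀ _ hn2.ne']
    linarith
  have hLpos : 0 < 1 - Lam x ^ 2 := by rw [hL]; positivity
  have hs2 : sfun x ^ 2 = 1 - Lam x ^ 2 := Real.sq_sqrt hLpos.le
  have hs : sfun x ≠ 0 := (Real.sqrt_pos.mpr hLpos).ne'
  have hh : x 0 ^ 2 + x 1 ^ 2 = sfun x ^ 2 * ‖x‖ ^ 2 := by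
    rw [hs2, hL, div_mul_cancel₀ _ hn2.ne']
  have h : ‖wvec x‖ ^ 2 = ‖x‖ ^ 2 := by
    rw [norm_sq_E3 (wvec x)]
    have h0 : wvec x 0 = Lam x / sfun x * x 0 := by simp [wvec, hpart, e₃, Ev3]
    have h1 : wvec x 1 = Lam x / sfun x * x 1 := by simp [wvec, hpart, e₃, Ev3]
    have h2 : wvec x 2 = -(‖x‖ * sfun x) := by simp [wvec, hpart, e₃, Ev3]
    rw [h0, h1, h2]
    calc _ = (Lam x / sfun x) ^ 2 * (x 0 ^ 2 + x 1 ^ 2) + ‖x‖ ^ 2 * sfun x ^ 2 := by ring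
      _ = ‖x‖ ^ 2 * (Lam x ^ 2 + sfun x ^ 2) := by rw [hh]; field_simp
      _ = ‖x‖ ^ 2 := by rw [hs2]; ring
  exact (sq_eq_sq₀ (norm_nonneg _) (norm_nonneg _)).mp h

theorem abs_inner_gradLam_le {x : E3} (hx : x ≠ 0) (v : E3) :
    |⟪gradLam x, v⟫| ≤ ‖v‖ / ‖x‖ * sfun x := by
  refine (abs_real_inner_le_norm _ _).trans_eq ?_
  rw [norm_gradLam hx]
  ring

/-- **Bound `|Υ_ξΦ| ≤ √(1−Λ(ξ)²) + (‖ξ‖/‖ξ−η‖)√(1−Λ(ξ−η)²)` (equation (6.13)).**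
For `ξ_h ≠ 0`, `ξ ≠ η` and `μ ∈ {−1,+1}`, the map `ξ' ↦ Λ(ξ') + μΛ(ξ'−η)` is differentiable
at `ξ` and its directional derivative along `w(ξ)` obeys the stated bound. -/
theorem stmt_14 (ξ η : E3) (hξ : hpart ξ ≠ 0) (hne : ξ ≠ η)
    (μ : ℝ) (hμ : μ = -1 ∨ μ = 1) :
    DifferentiableAt ℝ (fun ξ' : E3 => Lam ξ' + μ * Lam (ξ' - η)) ξ ∧
    |fderiv ℝ (fun ξ' : E3 => Lam ξ' + μ * Lam (ξ' - η)) ξ (wvec ξ)|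
      ≤ Real.sqrt (1 - Lam ξ ^ 2) + (‖ξ‖ / ‖ξ - η‖) * Real.sqrt (1 - Lam (ξ - η) ^ 2) := by
  have hx : ξ ≠ 0 := by
    rintro rfl
    apply hξ
    ext i
    fin_cases i <;> simp [hpart, Ev3]
  have hy : ξ - η ≠ 0 := sub_ne_zero.mpr hne
  have hd : HasFDerivAt (fun ξ' : E3 => Lam ξ' + μ * Lam (ξ' - η))
      (innerSL ℝ (gradLam ξ) + μ • innerSL ℝ (gradLam (ξ - η))) ξ := by
    have h : HasFDerivAt (fun ξ' : E3 => Lam (ξ' - η)) (innerSL ℝ (gradLam (ξ - η))) ξ :=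
      (hasFDerivAt_Lam hy).comp (f := fun ξ' : E3 => ξ' - η) ξ ((hasFDerivAt_id ξ).sub_const η)
    exact (hasFDerivAt_Lam hx).add (h.const_mul μ)
  refine ⟨hd.differentiableAt, ?_⟩
  have hμ' : |μ| = 1 := by rcases hμ with rfl | rfl <;> simp
  have h1 := abs_inner_gradLam_le hx (wvec ξ)
  have h2 := abs_inner_gradLam_le hy (wvec ξ)
  rw [norm_wvec hξ] at h1 h2
  rw [div_self (norm_ne_zero_iff.mpr hx), one_mul] at h1
  rw [hd.fderiv]
  calc |⟪gradLam ξ, wvec ξ⟫ + μ * ⟪gradLam (ξ - η), wvec ξ⟫|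
      ≤ |⟪gradLam ξ, wvec ξ⟫| + |μ * ⟪gradLam (ξ - η), wvec ξ⟫| := abs_add_le _ _
    _ ≤ _ := by
      rw [abs_mul, hμ', one_mul]
      exact add_le_add h1 h2
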